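/- Let P_1 and P_2 be d-dimensional lattice polytopes in ℝ^d. Then the first entry of the mixed h*-vector satisfies h_1*(P_1,P_2) = DMV(P_1,P_2); in particular, h_1*(P_1,P_2) ≥ 0. -/

import Mathlib

open Pointwise MeasureTheory Filter
open scoped Classical

/-- A lattice polytope in `ℝ^d`: the convex hull of finitely many integer points. -/
def IsLatticePolytope {d : ℕ} (P : Set (Fin d → ℝ)) : Prop :=
  ∃ V : Finset (Fin d → ℤ), V.Nonempty ∧
    P = convexHull ℝ ((fun z : Fin d → ℤ => fun i => (z i : ℝ)) '' ↑V)

/-- The number of lattice points of a subset of `ℝ^d`. -/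
noncomputable def latticePointCount {d : ℕ} (P : Set (Fin d → ℝ)) : ℕ :=
  Set.ncard {z : Fin d → ℤ | (fun i => (z i : ℝ)) ∈ P}

/-- The discrete mixed volume `DMV(P_1, …, P_k)`; here `∑ j ∈ J, P j` is a Minkowski
sum of sets, with the empty sum being `{0}`. -/
noncomputable def DMV {d k : ℕ} (P : Fin k → Set (Fin d → ℝ)) : ℤ :=
  ∑ J : Finset (Fin k), (-1) ^ (k - J.card) * (latticePointCount (∑ j ∈ J, P j) : ℤ)

/-- The dimension of a polytope: the dimension of its affine hull. -/
noncomputable def polytopeDim {d : ℕ} (P : Set (Fin d → ℝ)) : ℕ :=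
  Module.finrank ℝ (affineSpan ℝ P).direction

/-- A bounded subset of `ℝ^d` contains only finitely many lattice points. -/
theorem finite_latticePoints_of_isBounded {d : ℕ} {P : Set (Fin d → ℝ)}
    (hP : Bornology.IsBounded P) :
    {z : Fin d → ℤ | (fun i => (z i : ℝ)) ∈ P}.Finite := by
  obtain ⟨R, hR⟩ := hP.exists_norm_le
  refine (Set.finite_Icc (fun _ : Fin d => -⌈R⌉) (fun _ => ⌈R⌉)).subset fun z hz => ?_
  have key (i : Fin d) : |(z i : ℝ)| ≤ ⌈R⌉ :=
    ((norm_le_pi_norm (fun i => (z i : ℝ)) i).trans (hR _ hz)).trans (Int.le_ceil R)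
  refine ⟨fun i => ?_, fun i => ?_⟩
  · exact_mod_cast (abs_le.mp (key i)).1
  · exact_mod_cast (abs_le.mp (key i)).2

theorem IsLatticePolytope.isBounded {d : ℕ} {P : Set (Fin d → ℝ)} (hP : IsLatticePolytope P) :
    Bornology.IsBounded P := by
  obtain ⟨V, -, rfl⟩ := hP
  exact isBounded_convexHull.2 (V.finite_toSet.image _).isBounded

theorem IsLatticePolytope.exists_latticePoint_mem {d : ℕ} {P : Set (Fin d → ℝ)}
    (hP : IsLatticePolytope P) : ∃ z : Fin d → ℤ, (fun i => (z i : ℝ)) ∈ P := by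
  obtain ⟨V, ⟨v, hv⟩, rfl⟩ := hP
  exact ⟨v, subset_convexHull ℝ _ ⟨v, hv, rfl⟩⟩

theorem latticePointCount_zero {d : ℕ} : latticePointCount (0 : Set (Fin d → ℝ)) = 1 := by
  rw [latticePointCount, Set.ncard_eq_one]
  refine ⟨0, ?_⟩
  ext z
  simp [funext_iff]

/-- Superadditivity of the lattice point count under Minkowski sums. -/
theorem latticePointCount_add_le {d : ℕ} {P Q : Set (Fin d → ℝ)}
    (hP : IsLatticePolytope P) (hQ : IsLatticePolytope Q) :
    latticePointCount P + latticePointCount Q ≤ latticePointCount (P + Q) + 1 := by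
  obtain ⟨p, hp⟩ := hP.exists_latticePoint_mem
  obtain ⟨q, hq⟩ := hQ.exists_latticePoint_mem
  have hA := finite_latticePoints_of_isBounded hP.isBounded
  have hB := finite_latticePoints_of_isBounded hQ.isBounded
  have hAB := finite_latticePoints_of_isBounded (hP.isBounded.add hQ.isBounded)
  have hcd := cauchy_davenport_of_isAddTorsionFree
    (s := hA.toFinset) (t := hB.toFinset) ⟨p, by simpa using hp⟩ ⟨q, by simpa using hq⟩
  have hsub : hA.toFinset + hB.toFinset ⊆ hAB.toFinset := by
    intro z hz
    obtain ⟨x, hx, y, hy, rfl⟩ := Finset.mem_add.1 hz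
    rw [Set.Finite.mem_toFinset, Set.mem_ofPred_eq] at hx hy ⊢
    refine ⟨_, hx, _, hy, ?_⟩
    ext i
    simp
  have hcard := Finset.card_le_card hsub
  rw [latticePointCount, latticePointCount, latticePointCount, Set.ncard_eq_toFinset_card _ hA,
    Set.ncard_eq_toFinset_card _ hB, Set.ncard_eq_toFinset_card _ hAB]
  omega

/-- The discrete mixed volume of a pair, written out. -/
theorem DMV_pair {d : ℕ} (P : Fin 2 → Set (Fin d → ℝ)) :
    DMV P = (latticePointCount (P 0 + P 1) : ℤ) - latticePointCount (P 0)
      - latticePointCount (P 1) + 1 := by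
  have huniv : (Finset.univ : Finset (Finset (Fin 2))) = {∅, {0}, {1}, {0, 1}} := by
    decide
  rw [DMV, huniv]
  rw [Finset.sum_insert (by decide), Finset.sum_insert (by decide),
    Finset.sum_insert (by decide), Finset.sum_singleton _ ({0, 1} : Finset (Fin 2))]
  rw [Finset.sum_pair (by decide), Finset.card_pair (by decide)]
  simp only [Finset.sum_empty, Finset.sum_singleton, Finset.card_empty, Finset.card_singleton,
    latticePointCount_zero]
  push_cast
  ring

/-- **The first entry of the mixed `h^*`-vector of two polytopes.**
Let `P_1, P_2` be `d`-dimensional lattice polytopes in `ℝ^d` and let `h` be the mixed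
`h^*`-vector of `(P_1, P_2)`, i.e.
`ME_{P_1,P_2}(n) = ∑_{i=0}^d h_i binom(n + d - i, d)` for all `n ≥ 0`.
Then `h_1 = DMV(P_1, P_2)`; in particular `h_1 ≥ 0`. -/
theorem mixed_hstar_one_of_two_polytopes
    {d : ℕ} (hd : 1 ≤ d) (P₁ P₂ : Set (Fin d → ℝ))
    (hP₁ : IsLatticePolytope P₁) (hP₂ : IsLatticePolytope P₂)
    (hP₁dim : polytopeDim P₁ = d) (hP₂dim : polytopeDim P₂ = d)
    (h : ℕ → ℝ)
    (hh : ∀ n : ℕ, (DMV (fun j : Fin 2 => (n : ℝ) • ![P₁, P₂] j) : ℝ)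
      = ∑ i ∈ Finset.range (d + 1), h i * ((n + d - i).choose d : ℕ)) :
    h 1 = (DMV ![P₁, P₂] : ℝ) ∧ 0 ≤ h 1 := by
  have hne₁ : P₁.Nonempty := hP₁.exists_latticePoint_mem.imp' _ fun _ => id
  have hne₂ : P₂.Nonempty := hP₂.exists_latticePoint_mem.imp' _ fun _ => id
  have h_zero : h 0 = 0 := by
    have h0 := hh 0
    rw [DMV_pair, Finset.sum_range_succ', Finset.sum_eq_zero] at h0
    · simpa [Set.zero_smul_set hne₁, Set.zero_smul_set hne₂, latticePointCount_zero] using h0.symm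
    · intro i hi
      rw [Nat.choose_eq_zero_of_lt (by have := Finset.mem_range.1 hi; omega)]
      simp
  have h_one : h 1 = (DMV ![P₁, P₂] : ℝ) := by
    have h1 := hh 1
    obtain ⟨e, rfl⟩ : ∃ e, d = e + 1 := ⟨d - 1, by omega⟩
    rw [Finset.sum_range_succ', Finset.sum_range_succ', Finset.sum_eq_zero] at h1
    · simpa [h_zero] using h1.symm
    · intro i hi
      rw [Nat.choose_eq_zero_of_lt (by have := Finset.mem_range.1 hi; omega)]
      simp
  refine ⟨h_one, ?_⟩
  rw [h_one, DMV_pair]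
  have hle := latticePointCount_add_le hP₁ hP₂
  simp only [Matrix.cons_val_zero, Matrix.cons_val_one]
  exact_mod_cast (by omega : (0 : ℤ) ≤ (latticePointCount (P₁ + P₂) : ℤ) - latticePointCount P₁
    - latticePointCount P₂ + 1)
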